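/- Let H : ℝ^{2n} → ℝ be continuously differentiable and let g(τ|x₀) be its Hamiltonian flow. Define the extended Hamiltonian ℋ₂ : ℝ^{4n} → ℝ by ℋ₂(x,y) = H(x - (1/2)Jy) - H(x + (1/2)Jy). Then for any z₀ = (x₀,y₀) ∈ ℝ^{4n}, with l₀ = x₀ - (1/2)Jy₀ and r₀ = x₀ + (1/2)Jy₀, the curve G(τ) = (x(τ), y(τ)) given by x(τ) = (1/2)(g(τ|l₀) + g(τ|r₀)) and y(τ) = J(g(τ|l₀) - g(τ|r₀)) solves the extended Hamiltonian system dG/dτ = J̃∇ℋ₂(G(τ)) with G(0) = z₀ (on the time interval on which both flows are defined). -/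

import Mathlib

open Matrix MeasureTheory

noncomputable section

abbrev Vec (n : ℕ) := Fin (2*n) → ℝ

/-- The `2n×2n` symplectic matrix `J = [[0, Iₙ], [-Iₙ, 0]]`. -/
def symJ (n : ℕ) : Matrix (Fin (2*n)) (Fin (2*n)) ℝ :=
  Matrix.of fun i j =>
    if i.val < n ∧ j.val = i.val + n then 1
    else if j.val < n ∧ i.val = j.val + n then -1 else 0

/-- Gradient of a scalar function on `ℝ^m`, as the vector of partial derivatives. -/
def grad {m : ℕ} (f : (Fin m → ℝ) → ℝ) (x : Fin m → ℝ) : Fin m → ℝ :=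
  fun i => fderiv ℝ f x (Pi.single i 1)

/-- Primary Poisson bracket `{f,g}₁(x) = ∇f(x) · J ∇g(x)`. -/
def pb1 (n : ℕ) (f g : Vec n → ℝ) (x : Vec n) : ℝ :=
  grad f x ⬝ᵥ (symJ n).mulVec (grad g x)

/-- `x`-gradient of a function on secondary phase space `ℝ^{2n} × ℝ^{2n}`. -/
def grad2x (n : ℕ) (F : Vec n × Vec n → ℝ) (z : Vec n × Vec n) : Vec n :=
  fun i => fderiv ℝ F z (Pi.single i 1, 0)

/-- `y`-gradient of a function on secondary phase space `ℝ^{2n} × ℝ^{2n}`. -/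
def grad2y (n : ℕ) (F : Vec n × Vec n → ℝ) (z : Vec n × Vec n) : Vec n :=
  fun i => fderiv ℝ F z (0, Pi.single i 1)

/-- Secondary Poisson bracket `{F,G}₂(z) = ∇F(z) · J̃ ∇G(z)` with
`J̃ = [[0, I_{2n}], [-I_{2n}, 0]]`, i.e. `∇ₓF·∇_yG - ∇_yF·∇ₓG`. -/
def pb2 (n : ℕ) (F G : Vec n × Vec n → ℝ) (z : Vec n × Vec n) : ℝ :=
  grad2x n F z ⬝ᵥ grad2y n G z - grad2y n F z ⬝ᵥ grad2x n G z

/-- Left projection `l(x,y) = x - (1/2) J y`. -/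
def lmap (n : ℕ) (z : Vec n × Vec n) : Vec n := z.1 - (1/2 : ℝ) • (symJ n).mulVec z.2

/-- Right projection `r(x,y) = x + (1/2) J y`. -/
def rmap (n : ℕ) (z : Vec n × Vec n) : Vec n := z.1 + (1/2 : ℝ) • (symJ n).mulVec z.2

/-- Hessian matrix of a scalar function on `ℝ^m`. -/
def hess {m : ℕ} (f : (Fin m → ℝ) → ℝ) (x : Fin m → ℝ) : Matrix (Fin m) (Fin m) ℝ :=
  Matrix.of fun i j => fderiv ℝ (fun y => fderiv ℝ f y (Pi.single j 1)) x (Pi.single i 1)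

/-- Jacobian matrix of a map `ℝ^m → ℝ^m`. -/
def jac {m : ℕ} (f : (Fin m → ℝ) → (Fin m → ℝ)) (x : Fin m → ℝ) :
    Matrix (Fin m) (Fin m) ℝ :=
  Matrix.of fun i j => fderiv ℝ f x (Pi.single j 1) i

/-- Operator norm of a matrix acting on Euclidean space `ℝ^m`. -/
def opNorm {m : ℕ} (A : Matrix (Fin m) (Fin m) ℝ) : ℝ :=
  ‖Matrix.toEuclideanCLM (𝕜 := ℝ) A‖

/-- Symplectic pairing `x ∧ y = x · J y`. -/
def wedgeP (n : ℕ) (x y : Vec n) : ℝ := x ⬝ᵥ (symJ n).mulVec y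

theorem symJ_transpose (n : ℕ) : (symJ n)ᵀ = -symJ n := by
  ext i j
  simp only [symJ, Matrix.transpose_apply, Matrix.of_apply, Matrix.neg_apply]
  split_ifs <;> first | omega | norm_num

theorem symJ_mulVec_apply (n : ℕ) (v : Vec n) (i : Fin (2*n)) :
    (symJ n).mulVec v i =
      if h : i.val < n then v ⟨i.val + n, by omega⟩ else -v ⟨i.val - n, by omega⟩ := by
  unfold Matrix.mulVec dotProduct
  split_ifs with h
  · rw [Finset.sum_eq_single (⟨i.val + n, by omega⟩ : Fin (2*n))]
    · simp [symJ, h]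
    · intro j _ hj
      have hj' : j.val ≠ i.val + n := fun e => hj (Fin.ext e)
      simp only [symJ, Matrix.of_apply]
      rw [if_neg (by omega), if_neg (by omega), zero_mul]
    · simp
  · rw [Finset.sum_eq_single (⟨i.val - n, by omega⟩ : Fin (2*n))]
    · simp only [symJ, Matrix.of_apply]
      rw [if_neg (by omega), if_pos (by have := i.isLt; constructor <;> omega)]
      ring
    · intro j _ hj
      have hj' : j.val ≠ i.val - n := fun e => hj (Fin.ext e)
      simp only [symJ, Matrix.of_apply]
      rw [if_neg (by omega), if_neg (by omega), zero_mul]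
    · simp

theorem symJ_symJ (n : ℕ) (v : Vec n) : (symJ n).mulVec ((symJ n).mulVec v) = -v := by
  ext i
  have hi := i.isLt
  rw [symJ_mulVec_apply]
  split_ifs with h
  · rw [symJ_mulVec_apply, dif_neg (by simp)]
    simp
  · rw [symJ_mulVec_apply, dif_pos (by simp; omega)]
    simp only [Pi.neg_apply]
    congr 2
    ext
    simp
    omega

theorem fderiv_eq_dot {m : ℕ} (f : (Fin m → ℝ) → ℝ) (x v : Fin m → ℝ) :
    fderiv ℝ f x v = v ⬝ᵥ grad f x := by
  conv_lhs => rw [pi_eq_sum_univ' v]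
  simp [map_sum, dotProduct, grad]

/-- `J` as a continuous linear map. -/
def JL (n : ℕ) : Vec n →L[ℝ] Vec n := LinearMap.toContinuousLinearMap (symJ n).mulVecLin

theorem JL_apply (n : ℕ) (v : Vec n) : JL n v = (symJ n).mulVec v := rfl

theorem fderiv_H2 (n : ℕ) (H : Vec n → ℝ) (hH : Differentiable ℝ H) (z w : Vec n × Vec n) :
    fderiv ℝ (fun z => H (lmap n z) - H (rmap n z)) z w =
      fderiv ℝ H (lmap n z) (lmap n w) - fderiv ℝ H (rmap n z) (rmap n w) := by
  let L : Vec n × Vec n →L[ℝ] Vec n := ContinuousLinearMap.fst ℝ _ _ -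
    (1/2 : ℝ) • (JL n).comp (ContinuousLinearMap.snd ℝ _ _)
  let R : Vec n × Vec n →L[ℝ] Vec n := ContinuousLinearMap.fst ℝ _ _ +
    (1/2 : ℝ) • (JL n).comp (ContinuousLinearMap.snd ℝ _ _)
  have hL : HasFDerivAt (lmap n) L z := L.hasFDerivAt
  have hR : HasFDerivAt (rmap n) R z := R.hasFDerivAt
  have h := ((hH (lmap n z)).hasFDerivAt.comp z hL).sub ((hH (rmap n z)).hasFDerivAt.comp z hR)
  have h' : HasFDerivAt (fun z => H (lmap n z) - H (rmap n z)) _ z := h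
  rw [h'.fderiv]
  rfl

theorem J_single_dot (n : ℕ) (i : Fin (2*n)) (v : Vec n) :
    (symJ n).mulVec (Pi.single i 1) ⬝ᵥ v = -(symJ n).mulVec v i := by
  rw [dotProduct_comm, Matrix.dotProduct_mulVec, ← Matrix.mulVec_transpose, symJ_transpose,
    Matrix.neg_mulVec]
  simp

/-- for the Heisenberg extended Hamiltonian
`ℋ₂(x,y) = H(x - (1/2)Jy) - H(x + (1/2)Jy)`, the curve
`G(τ) = ((1/2)(g(τ|l₀) + g(τ|r₀)), J(g(τ|l₀) - g(τ|r₀)))` solves the extended Hamiltonian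
system `dG/dτ = J̃∇ℋ₂(G(τ))` with `G(0) = (x₀,y₀)`. -/
theorem stmt4 (n : ℕ) (H : Vec n → ℝ) (hH : ContDiff ℝ 1 H)
    (g : ℝ → Vec n → Vec n)
    (hg0 : ∀ x₀, g 0 x₀ = x₀)
    (hgflow : ∀ x₀ τ, HasDerivAt (fun s => g s x₀) ((symJ n).mulVec (grad H (g τ x₀))) τ)
    (x₀ y₀ : Vec n) :
    let H₂ : Vec n × Vec n → ℝ := fun z => H (lmap n z) - H (rmap n z)
    let l₀ : Vec n := x₀ - (1/2 : ℝ) • (symJ n).mulVec y₀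
    let r₀ : Vec n := x₀ + (1/2 : ℝ) • (symJ n).mulVec y₀
    let G : ℝ → Vec n × Vec n := fun τ =>
      ((1/2 : ℝ) • (g τ l₀ + g τ r₀), (symJ n).mulVec (g τ l₀ - g τ r₀))
    G 0 = (x₀, y₀) ∧
    ∀ τ, HasDerivAt G (grad2y n H₂ (G τ), -(grad2x n H₂ (G τ))) τ := by
  intro H₂ l₀ r₀ G
  have hd : Differentiable ℝ H := hH.differentiable (by norm_num)
  have hl : ∀ τ, lmap n (G τ) = g τ l₀ := by
    intro τ
    simp only [lmap, G, symJ_symJ]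
    module
  have hr : ∀ τ, rmap n (G τ) = g τ r₀ := by
    intro τ
    simp only [rmap, G, symJ_symJ]
    module
  refine ⟨?_, fun τ => ?_⟩
  · simp only [G, hg0]
    refine Prod.ext ?_ ?_
    · simp only [l₀, r₀]
      module
    · have : l₀ - r₀ = -(symJ n).mulVec y₀ := by
        simp only [l₀, r₀]
        module
      simp only [this, Matrix.mulVec_neg, symJ_symJ, neg_neg]
  · have hx := ((hgflow l₀ τ).add (hgflow r₀ τ)).const_smul (1/2 : ℝ)
    have hy := (JL n).hasFDerivAt.comp_hasDerivAt τ ((hgflow l₀ τ).sub (hgflow r₀ τ))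
    have hG := hx.prodMk hy
    refine HasDerivAt.congr_deriv (f := G) hG ?_
    refine Prod.ext ?_ ?_
    · ext i
      simp only [grad2y, H₂]
      rw [fderiv_H2 n H hd, hl, hr, fderiv_eq_dot, fderiv_eq_dot]
      simp only [lmap, rmap, zero_sub, zero_add, neg_dotProduct, smul_dotProduct, J_single_dot,
        Pi.smul_apply, Pi.add_apply, smul_eq_mul]
      ring
    · ext i
      simp only [grad2x, H₂, Pi.neg_apply]
      rw [fderiv_H2 n H hd, hl, hr, fderiv_eq_dot, fderiv_eq_dot]
      simp only [JL_apply, Matrix.mulVec_sub, symJ_symJ]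
      simp [lmap, rmap]
      try ring
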